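/- Let f : G → G be a graph map. Then cl(R(f)) ∩ cl(EP(f)) = cl(P(f)). -/

import Mathlib

open Set Function Filter Topology Metric

noncomputable section

/-- An open arc: a subspace homeomorphic to the open interval `(0,1)`. -/
def IsOpenArc {G : Type*} [TopologicalSpace G] (A : Set G) : Prop :=
  Nonempty (A ≃ₜ Set.Ioo (0 : ℝ) 1)

/-- A circle: a subspace homeomorphic to the unit circle. -/
def IsCircle {G : Type*} [TopologicalSpace G] (C : Set G) : Prop :=
  Nonempty (C ≃ₜ Metric.sphere (0 : ℂ) 1)

/-- A (topological) graph: a non-degenerate compact connected metric space with a finite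
vertex set `V` such that every connected component of the complement of `V` is an open arc,
and every circle contains at least three vertices. -/
structure IsTopGraph {G : Type*} [MetricSpace G] (V : Set G) : Prop where
  nontrivial : Nontrivial G
  compact : CompactSpace G
  connected : ConnectedSpace G
  finite_vertexSet : V.Finite
  component_openArc : ∀ x ∈ Vᶜ, IsOpenArc (connectedComponentIn Vᶜ x)
  circle_vertices : ∀ C : Set G, IsCircle C → 3 ≤ (C ∩ V).ncard

/-- The set of eventually periodic points: points with finite orbit. -/
def evPeriodicPts {G : Type*} (f : G → G) : Set G :=
  {x | (Set.range fun n : ℕ => f^[n] x).Finite}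

/-- `EP_n(f)`: points whose orbit contains at most `n` points. -/
def evPeriodicPtsLe {G : Type*} (f : G → G) (n : ℕ) : Set G :=
  {x | (Set.range fun i : ℕ => f^[i] x).encard ≤ n}

/-- The ω-limit set of a point `x` under `f`. -/
def omegaSet {G : Type*} [TopologicalSpace G] (f : G → G) (x : G) : Set G :=
  ⋂ i : ℕ, closure (Set.range fun n : ℕ => f^[n + i] x)

/-- The ω-limit set of `f`. -/
def omegaLimitSet {G : Type*} [TopologicalSpace G] (f : G → G) : Set G :=
  ⋃ x : G, omegaSet f x

/-- The set of recurrent points of `f`. -/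
def recurrentPts {G : Type*} [TopologicalSpace G] (f : G → G) : Set G :=
  {x | x ∈ omegaSet f x}

/-- The set of non-wandering points of `f`. -/
def nonwanderingPts {G : Type*} [TopologicalSpace G] (f : G → G) : Set G :=
  {x | ∀ U : Set G, IsOpen U → x ∈ U → ∃ n : ℕ, 0 < n ∧ (f^[n] '' U ∩ U).Nonempty}

/-- The set of almost periodic points of `f`. -/
def almostPeriodicPts {G : Type*} [TopologicalSpace G] (f : G → G) : Set G :=
  {x | ∀ U : Set G, IsOpen U → x ∈ U →
    ∃ m : ℕ, 0 < m ∧ ∀ n : ℕ, ∃ i : ℕ, 1 ≤ i ∧ i ≤ m ∧ f^[n + i] x ∈ U}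

/-- The ω-limit set of `x` under the restriction `f|K` (closures taken in the subspace `K`). -/
def omegaSetIn {G : Type*} [TopologicalSpace G] (f : G → G) (K : Set G) (x : G) : Set G :=
  ⋂ i : ℕ, (closure (Set.range fun n : ℕ => f^[n + i] x) ∩ K)

/-- The ω-limit set `ω(f|K)` of the restriction of `f` to `K`. -/
def omegaLimitSetIn {G : Type*} [TopologicalSpace G] (f : G → G) (K : Set G) : Set G :=
  ⋃ x ∈ K, omegaSetIn f K x

/-- The non-wandering set `Ω(f|K)` of the restriction of `f` to `K`. -/
def nonwanderingPtsIn {G : Type*} [TopologicalSpace G] (f : G → G) (K : Set G) : Set G :=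
  {x | x ∈ K ∧ ∀ U : Set G, IsOpen U → x ∈ U →
    ∃ n : ℕ, 0 < n ∧ (f^[n] '' (U ∩ K) ∩ (U ∩ K)).Nonempty}

/-- The almost periodic set `AP(f|K)` of the restriction of `f` to `K`. -/
def almostPeriodicPtsIn {G : Type*} [TopologicalSpace G] (f : G → G) (K : Set G) : Set G :=
  {x | x ∈ K ∧ ∀ U : Set G, IsOpen U → x ∈ U →
    ∃ m : ℕ, 0 < m ∧ ∀ n : ℕ, ∃ i : ℕ, 1 ≤ i ∧ i ≤ m ∧ f^[n + i] x ∈ U}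

/-- The orbit `O(K,f)` of a set `K` under `f`. -/
def setOrbit {G : Type*} (f : G → G) (K : Set G) : Set G := ⋃ i : ℕ, f^[i] '' K

/-- The orbit segment `O_n(K,f)`. -/
def setOrbitSeg {G : Type*} (f : G → G) (K : Set G) (n : ℕ) : Set G :=
  ⋃ i ≤ n, f^[i] '' K

/-- The inverse orbit (absorbed set) `O₋(K,f)`. -/
def invOrbit {G : Type*} (f : G → G) (K : Set G) : Set G := ⋃ i : ℕ, f^[i] ⁻¹' K

/-- The main absorbed set `Ab(K,f)`: the union of the connected components of `O₋(K,f)`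
that meet `K`. -/
def mainAbsorbed {G : Type*} [TopologicalSpace G] (f : G → G) (K : Set G) : Set G :=
  ⋃ x ∈ K, connectedComponentIn (invOrbit f K) x

/-- A minimal set of `f`: nonempty, closed, invariant, with no proper such subset. -/
def IsMinimalSet {G : Type*} [TopologicalSpace G] (f : G → G) (M : Set G) : Prop :=
  M.Nonempty ∧ IsClosed M ∧ f '' M ⊆ M ∧
    ∀ N : Set G, N ⊆ M → N.Nonempty → IsClosed N → f '' N ⊆ N → N = M

open Classical in
/-- The valence of a point `x` in a metric space: the limit, as `r → 0⁺`, of the number of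
boundary points of the ball `B(x,r)` (defined as the eventual value, if it exists). -/
def valence {G : Type*} [MetricSpace G] (x : G) : ℕ :=
  if h : ∃ n : ℕ, ∀ᶠ r in nhdsWithin (0 : ℝ) (Set.Ioi 0),
      (frontier (Metric.ball x r)).ncard = n
  then h.choose else 0

/-- The set of branching points. -/
def branchPts (G : Type*) [MetricSpace G] : Set G := {x | 2 < valence x}

/-- The total branching number `ξ(U)` of a subset `U` of `G`. -/
def totalBranch {G : Type*} [MetricSpace G] (U : Set G) : ℕ :=
  ∑ᶠ v ∈ U ∩ branchPts G, (valence v - 2)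

/-- Cyclic successor on `Fin k`. -/
def finSucc {k : ℕ} (i : Fin k) : Fin k := ⟨(i.1 + 1) % k, Nat.mod_lt _ i.pos⟩

/-- `C : Fin k → Set G` enumerates the connected components of `X`, and `f` maps each
component into the (cyclically) next one. -/
def IsCyclicDecomp {G : Type*} [TopologicalSpace G] (f : G → G) (X : Set G)
    {k : ℕ} (C : Fin k → Set G) : Prop :=
  (⋃ i, C i) = X ∧ (∀ i, (C i).Nonempty) ∧
  (∀ i, ∀ x ∈ C i, connectedComponentIn X x = C i) ∧
  Function.Injective C ∧ ∀ i, f '' C i ⊆ C (finSucc i)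

/-- A component-cyclic `f`-invariant set. -/
def ComponentCyclic {G : Type*} [TopologicalSpace G] (f : G → G) (X : Set G) : Prop :=
  ∃ (k : ℕ) (C : Fin k → Set G), 0 < k ∧ IsCyclicDecomp f X C

/-- `A` is a connected component of `S`. -/
def IsCompOf {G : Type*} [TopologicalSpace G] (A S : Set G) : Prop :=
  ∃ x ∈ S, connectedComponentIn S x = A

/-- The distance between two sets. -/
def setDist {G : Type*} [MetricSpace G] (A B : Set G) : ℝ :=
  sInf {r : ℝ | ∃ a ∈ A, ∃ b ∈ B, dist a b = r}

end

section Arc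

variable {G : Type*} [MetricSpace G] {φ : ℝ → G} {a b : ℝ}

/-- A path that ends in an open arc and starts outside it has a last entrance, which happens
through one of the two endpoints of the arc. -/
lemma exists_last_entrance (hφ : ContinuousOn φ (Icc a b)) (hO : IsOpen (φ '' Ioo a b))
    {h : ℝ → G} {c d : ℝ} (hcd : c ≤ d) (hh : ContinuousOn h (Icc c d))
    (hc : h c ∉ φ '' Ioo a b) (hd : h d ∈ φ '' Ioo a b) :
    ∃ s ∈ Ico c d, (h s = φ a ∨ h s = φ b) ∧ ∀ t ∈ Ioc s d, h t ∈ φ '' Ioo a b := by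
  set K : Set ℝ := Icc c d ∩ h ⁻¹' (φ '' Ioo a b)ᶜ with hK
  have hKc : IsCompact K :=
    isCompact_Icc.of_isClosed_subset (hh.preimage_isClosed_of_isClosed isClosed_Icc
      hO.isClosed_compl) inter_subset_left
  have hKne : K.Nonempty := ⟨c, ⟨le_rfl, hcd⟩, hc⟩
  obtain ⟨s, hsK, hs⟩ := hKc.exists_isGreatest hKne
  have hsd : s < d := lt_of_le_of_ne hsK.1.2 (by rintro rfl; exact hsK.2 hd)
  have hlast : ∀ t ∈ Ioc s d, h t ∈ φ '' Ioo a b := by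
    intro t ht
    by_contra hn
    exact absurd (hs ⟨⟨hsK.1.1.trans ht.1.le, ht.2⟩, hn⟩) (not_le.2 ht.1)
  refine ⟨s, ⟨hsK.1.1, hsd⟩, ?_, hlast⟩
  have hcl : h s ∈ closure (φ '' Ioo a b) := by
    have h1 : ContinuousWithinAt h (Ioc s d) s :=
      (hh s hsK.1).mono fun t ht => ⟨hsK.1.1.trans ht.1.le, ht.2⟩
    refine h1.mem_closure ?_ hlast
    rw [closure_Ioc hsd.ne]
    exact left_mem_Icc.2 hsd.le
  have hJ : closure (φ '' Ioo a b) ⊆ φ '' Icc a b :=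
    closure_minimal (image_mono Ioo_subset_Icc_self)
      (isCompact_Icc.image_of_continuousOn hφ).isClosed
  obtain ⟨r, hr, hrs⟩ := hJ hcl
  rcases eq_or_lt_of_le hr.1 with rfl | h1
  · exact Or.inl hrs.symm
  rcases eq_or_lt_of_le hr.2 with rfl | h2
  · exact Or.inr hrs.symm
  exact absurd ⟨r, ⟨h1, h2⟩, hrs⟩ hsK.2

/-- The coordinate on an arc. -/
lemma exists_coordinate (hφ : ContinuousOn φ (Icc a b)) (hinj : InjOn φ (Icc a b)) :
    ∃ ψ : G → ℝ, (∀ t ∈ Icc a b, ψ (φ t) = t) ∧ ContinuousOn ψ (φ '' Icc a b) := by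
  refine ⟨invFunOn φ (Icc a b), fun t ht => hinj.leftInvOn_invFunOn ht, ?_⟩
  rw [continuousOn_iff_isClosed]
  intro t ht
  refine ⟨φ '' (Icc a b ∩ t), ((isCompact_Icc.inter_right ht).image_of_continuousOn
    (hφ.mono inter_subset_left)).isClosed, ?_⟩
  ext p
  constructor
  · rintro ⟨hp, ⟨s, hs, rfl⟩⟩
    refine ⟨⟨s, ⟨hs, ?_⟩, rfl⟩, ⟨s, hs, rfl⟩⟩
    rwa [mem_preimage, hinj.leftInvOn_invFunOn hs] at hp
  · rintro ⟨⟨s, hs, rfl⟩, hp⟩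
    refine ⟨?_, hp⟩
    rw [mem_preimage, hinj.leftInvOn_invFunOn hs.1]
    exact hs.2

/-- Three consecutive points `φ τ₀ ↦ φ τ₁ ↦ φ τ₂` with `τ₁ < τ₂ < τ₀` on an arc whose initial
point is mapped outside the open arc force a fixed point. -/
lemma exists_fixed_of_returns (hφ : ContinuousOn φ (Icc a b)) (hinj : InjOn φ (Icc a b))
    (hO : IsOpen (φ '' Ioo a b)) {F₁ F₂ : G → G} (hF₁ : Continuous F₁) (hF₂ : Continuous F₂)
    (h₁a : F₁ (φ a) ∉ φ '' Ioo a b) (h₂a : F₂ (φ a) ∉ φ '' Ioo a b)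
    {τ₀ τ₁ τ₂ : ℝ} (h₀ : τ₀ < b) (h₁ : a < τ₁) (h₁₂ : τ₁ < τ₂) (h₂₀ : τ₂ < τ₀)
    (e₁ : F₁ (φ τ₀) = φ τ₁) (e₂ : F₂ (φ τ₁) = φ τ₂) :
    ∃ t ∈ Icc a b, F₁ (φ t) = φ t ∨ F₂ (φ t) = φ t ∨ F₂ (F₁ (φ t)) = φ t := by
  by_contra! hfix
  obtain ⟨ψ, hψ, hψc⟩ := exists_coordinate hφ hinj
  have hab : a < b := by linarith
  have hOJ : φ '' Ioo a b ⊆ φ '' Icc a b := image_mono Ioo_subset_Icc_self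
  have ha : a ∈ Icc a b := left_mem_Icc.2 hab.le
  have hb : b ∈ Icc a b := right_mem_Icc.2 hab.le
  have hm₁ : τ₁ ∈ Ioo a b := ⟨h₁, by linarith⟩
  have hm₂ : τ₂ ∈ Ioo a b := ⟨by linarith, by linarith⟩
  have hm₀ : τ₀ ∈ Ioo a b := ⟨by linarith, h₀⟩
  have haO : φ a ∉ φ '' Ioo a b := by
    rintro ⟨t, ht, e⟩
    exact ht.1.ne' (hinj (Ioo_subset_Icc_self ht) ha e)
  have hbO : φ b ∉ φ '' Ioo a b := by
    rintro ⟨t, ht, e⟩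
    exact ht.2.ne (hinj (Ioo_subset_Icc_self ht) hb e)
  have hφψ : ∀ p ∈ φ '' Icc a b, φ (ψ p) = p := by
    rintro _ ⟨t, ht, rfl⟩
    rw [hψ t ht]
  have hψm : ∀ p ∈ φ '' Icc a b, ψ p ∈ Icc a b := by
    rintro _ ⟨t, ht, rfl⟩
    rwa [hψ t ht]
  -- the intermediate value theorem in both directions
  have up : ∀ F : G → G, Continuous F → (∀ t ∈ Icc a b, F (φ t) ≠ φ t) → ∀ c d, a ≤ c → c ≤ d →
      d ≤ b → (∀ t ∈ Icc c d, F (φ t) ∈ φ '' Icc a b) → ψ (F (φ c)) ≤ c → d ≤ ψ (F (φ d)) →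
      False := by
    intro F hF hne c d hac hcd hdb hJ hc hd
    have hsub : Icc c d ⊆ Icc a b := Icc_subset_Icc hac hdb
    have hcont : ContinuousOn (fun t => ψ (F (φ t)) - t) (Icc c d) :=
      (hψc.comp (hF.comp_continuousOn (hφ.mono hsub)) hJ).sub continuousOn_id
    obtain ⟨t, ht, e⟩ := intermediate_value_Icc hcd hcont
      (show (0 : ℝ) ∈ _ from ⟨by linarith, by linarith⟩)
    apply hne t (hsub ht)
    rw [← hφψ _ (hJ t ht), sub_eq_zero.1 e]
  have down : ∀ F : G → G, Continuous F → (∀ t ∈ Icc a b, F (φ t) ≠ φ t) → ∀ c d, a ≤ c → c ≤ d →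
      d ≤ b → (∀ t ∈ Icc c d, F (φ t) ∈ φ '' Icc a b) → c ≤ ψ (F (φ c)) → ψ (F (φ d)) ≤ d →
      False := by
    intro F hF hne c d hac hcd hdb hJ hc hd
    have hsub : Icc c d ⊆ Icc a b := Icc_subset_Icc hac hdb
    have hcont : ContinuousOn (fun t => ψ (F (φ t)) - t) (Icc c d) :=
      (hψc.comp (hF.comp_continuousOn (hφ.mono hsub)) hJ).sub continuousOn_id
    obtain ⟨t, ht, e⟩ := intermediate_value_Icc' hcd hcont
      (show (0 : ℝ) ∈ _ from ⟨by linarith, by linarith⟩)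
    apply hne t (hsub ht)
    rw [← hφψ _ (hJ t ht), sub_eq_zero.1 e]
  have stay : ∀ (h : ℝ → G) (s d : ℝ), (h s = φ a ∨ h s = φ b) →
      (∀ t ∈ Ioc s d, h t ∈ φ '' Ioo a b) → ∀ t ∈ Icc s d, h t ∈ φ '' Icc a b := by
    intro h s d hs hl t ht
    rcases eq_or_lt_of_le ht.1 with rfl | hlt
    · rcases hs with e | e <;> rw [e]
      exacts [mem_image_of_mem _ ha, mem_image_of_mem _ hb]
    · exact hOJ (hl t ⟨hlt, ht.2⟩)
  have nf₁ : ∀ t ∈ Icc a b, F₁ (φ t) ≠ φ t := fun t ht => (hfix t ht).1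
  have nf₂ : ∀ t ∈ Icc a b, F₂ (φ t) ≠ φ t := fun t ht => (hfix t ht).2.1
  have nf : ∀ t ∈ Icc a b, (F₂ ∘ F₁) (φ t) ≠ φ t := fun t ht => (hfix t ht).2.2
  obtain ⟨s₀, hs₀, end₀, in₀⟩ := exists_last_entrance (h := fun t => F₁ (φ t)) hφ hO hm₀.1.le
    (hF₁.comp_continuousOn (hφ.mono (Icc_subset_Icc_right h₀.le))) h₁a (by
      rw [e₁]; exact mem_image_of_mem _ hm₁)
  have stay₀ := stay (fun t => F₁ (φ t)) _ _ end₀ in₀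
  have ea₀ : F₁ (φ s₀) = φ a := by
    refine end₀.resolve_right fun hn => down F₁ hF₁ nf₁ s₀ τ₀ hs₀.1 hs₀.2.le h₀.le stay₀ ?_ ?_
    · rw [show F₁ (φ s₀) = φ b from hn, hψ b hb]; linarith [hs₀.2]
    · rw [e₁, hψ _ (Ioo_subset_Icc_self hm₁)]; linarith
  obtain ⟨s₁, hs₁, end₁, in₁⟩ := exists_last_entrance (h := fun t => F₂ (φ t)) hφ hO h₁.le
    (hF₂.comp_continuousOn (hφ.mono (Icc_subset_Icc_right hm₁.2.le))) h₂a (by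
      rw [e₂]; exact mem_image_of_mem _ hm₂)
  have eb₁ : F₂ (φ s₁) = φ b := by
    refine end₁.resolve_left fun hn => up F₂ hF₂ nf₂ s₁ τ₁ hs₁.1 hs₁.2.le hm₁.2.le
      (stay (fun t => F₂ (φ t)) _ _ end₁ in₁) ?_ ?_
    · rw [show F₂ (φ s₁) = φ a from hn, hψ a ha]; exact hs₁.1
    · rw [e₂, hψ _ (Ioo_subset_Icc_self hm₂)]; exact h₁₂.le
  have hcoord : ContinuousOn (fun t => ψ (F₁ (φ t))) (Icc s₀ τ₀) :=
    hψc.comp (hF₁.comp_continuousOn (hφ.mono (Icc_subset_Icc hs₀.1 h₀.le))) stay₀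
  have hv₀ : ψ (F₁ (φ τ₀)) = τ₁ := by rw [e₁, hψ _ (Ioo_subset_Icc_self hm₁)]
  obtain ⟨t₂, ht₂, et₂⟩ := intermediate_value_Icc hs₀.2.le hcoord (show s₁ ∈ _ from
    ⟨by simp only [ea₀, hψ a ha]; exact hs₁.1, by simp only [hv₀]; exact hs₁.2.le⟩)
  have e₂' : F₁ (φ t₂) = φ s₁ := by rw [← hφψ _ (stay₀ _ ht₂)]; exact congrArg φ et₂
  have hsub₂ : Icc t₂ τ₀ ⊆ Icc a b := Icc_subset_Icc (hs₀.1.trans ht₂.1) h₀.le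
  obtain ⟨s, hs, ends, ins⟩ := exists_last_entrance (h := fun t => F₂ (F₁ (φ t))) hφ hO ht₂.2
    (hF₂.comp_continuousOn (hF₁.comp_continuousOn (hφ.mono hsub₂)))
    (by simp only [e₂', eb₁]; exact hbO) (by simp only [e₁, e₂]; exact mem_image_of_mem _ hm₂)
  have hs_mem : s ∈ Icc s₀ τ₀ := ⟨ht₂.1.trans hs.1, hs.2.le⟩
  have eas : F₂ (F₁ (φ s)) = φ a := by
    refine ends.resolve_right fun hn => down (F₂ ∘ F₁) (hF₂.comp hF₁) nf s τ₀
      (hs₀.1.trans hs_mem.1) hs.2.le h₀.le (stay _ _ _ ends ins) ?_ ?_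
    · simp only [comp_apply, hn, hψ b hb]; linarith [hs.2]
    · simp only [comp_apply, e₁, e₂, hψ _ (Ioo_subset_Icc_self hm₂)]; exact h₂₀.le
  set w := ψ (F₁ (φ s)) with hw
  have hwφ : φ w = F₁ (φ s) := hφψ _ (stay₀ _ hs_mem)
  have hwm : w ∈ Icc a b := hψm _ (stay₀ _ hs_mem)
  have hcoord' : ContinuousOn (fun t => ψ (F₁ (φ t))) (Icc s τ₀) :=
    hcoord.mono (Icc_subset_Icc_left hs_mem.1)
  -- values taken by the coordinate of `F₁` strictly after time `s` are sent into the open arc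
  have hpass : ∀ v, v ∈ (fun t => ψ (F₁ (φ t))) '' Icc s τ₀ → v ≠ w → F₂ (φ v) ∈ φ '' Ioo a b := by
    rintro _ ⟨t, ht, rfl⟩ hne
    have hst : s < t := lt_of_le_of_ne ht.1 (by rintro rfl; exact hne rfl)
    simp only [hφψ _ (stay₀ t ⟨hs_mem.1.trans ht.1, ht.2⟩)]
    exact ins t ⟨hst, ht.2⟩
  have hw₁ : τ₁ < w := by
    by_contra! hle
    rcases lt_trichotomy w s₁ with hlt | heq | hgt
    · have hmem := intermediate_value_Icc hs.2.le hcoord' (show s₁ ∈ _ from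
        ⟨hlt.le, by simp only [hv₀]; exact hs₁.2.le⟩)
      have := hpass s₁ hmem hlt.ne'
      rw [eb₁] at this
      exact hbO this
    · rw [← hwφ, heq, eb₁] at eas
      exact hab.ne' (hinj hb ha eas)
    · have := in₁ w ⟨hgt, hle⟩
      simp only [hwφ, eas] at this
      exact haO this
  refine down F₂ hF₂ nf₂ τ₁ w h₁.le hw₁.le hwm.2 ?_ ?_ ?_
  · intro v hv
    rcases eq_or_lt_of_le hv.2 with rfl | hlt
    · rw [hwφ, eas]; exact mem_image_of_mem _ ha
    · exact hOJ (hpass v (intermediate_value_Icc' hs.2.le hcoord'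
        ⟨by simp only [hv₀]; exact hv.1, hlt.le⟩) hlt.ne)
  · rw [e₂, hψ _ (Ioo_subset_Icc_self hm₂)]; exact h₁₂.le
  · rw [hwφ, eas, hψ a ha]; exact hwm.1

end Arc

section Orbits

variable {G : Type*} {f : G → G}

lemma periodicPts_subset_evPeriodicPts : periodicPts f ⊆ evPeriodicPts f := by
  rintro x ⟨m, hm, hx⟩
  refine ((finite_lt_nat m).image fun n => f^[n] x).subset ?_
  rintro _ ⟨n, rfl⟩
  exact ⟨n % m, Nat.mod_lt _ hm, hx.iterate_mod_apply n⟩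

lemma iterate_mem_evPeriodicPts {x : G} (hx : x ∈ evPeriodicPts f) (j : ℕ) :
    f^[j] x ∈ evPeriodicPts f := by
  refine Set.Finite.subset hx ?_
  rintro _ ⟨n, rfl⟩
  exact ⟨n + j, iterate_add_apply f n j x⟩

lemma iterate_mem_periodicPts {x : G} (hx : x ∈ periodicPts f) (j : ℕ) :
    f^[j] x ∈ periodicPts f := by
  obtain ⟨m, hm, hx⟩ := hx
  exact ⟨m, hm, hx.apply_iterate j⟩

lemma exists_iterate_mem_periodicPts {x : G} (hx : x ∈ evPeriodicPts f) :
    ∃ k, ∀ n ≥ k, f^[n] x ∈ periodicPts f := by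
  have hni : ¬ Injective fun n : ℕ => f^[n] x := fun hi => infinite_range_of_injective hi hx
  obtain ⟨i, j, hij, hlt⟩ : ∃ i j, f^[i] x = f^[j] x ∧ i < j := by
    simp only [Injective, not_forall] at hni
    obtain ⟨i, j, hij, hne⟩ := hni
    rcases Nat.lt_or_gt_of_ne hne with h | h
    · exact ⟨i, j, hij, h⟩
    · exact ⟨j, i, hij.symm, h⟩
  refine ⟨i, fun n hn => ?_⟩
  have hp : f^[i] x ∈ periodicPts f := by
    refine ⟨j - i, Nat.sub_pos_of_lt hlt, ?_⟩
    rw [IsPeriodicPt, IsFixedPt, ← iterate_add_apply, Nat.sub_add_cancel hlt.le, hij]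
  have := iterate_mem_periodicPts hp (n - i)
  rwa [← iterate_add_apply, Nat.sub_add_cancel hn] at this

end Orbits

section Recurrence

variable {G : Type*} [MetricSpace G] {f : G → G}

lemma exists_iterate_mem_of_recurrent {y : G} (hy : y ∈ recurrentPts f) {N : Set G} (hN : N ∈ 𝓝 y)
    (k : ℕ) : ∃ n, k ≤ n ∧ f^[n] y ∈ N := by
  have h := mem_iInter.1 hy k
  obtain ⟨_, hp, n, rfl⟩ := mem_closure_iff_nhds.1 h N hN
  exact ⟨n + k, Nat.le_add_left _ _, hp⟩

lemma mem_recurrentPts_of_exists_return {y : G}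
    (h : ∀ N ∈ 𝓝 y, ∀ k, ∃ n, k ≤ n ∧ f^[n] y ∈ N) : y ∈ recurrentPts f := by
  refine mem_iInter.2 fun k => mem_closure_iff_nhds.2 fun N hN => ?_
  obtain ⟨n, hkn, hn⟩ := h N hN k
  exact ⟨_, hn, n - k, by simp only [Nat.sub_add_cancel hkn]⟩

lemma iterate_mem_recurrentPts (hf : Continuous f) {y : G} (hy : y ∈ recurrentPts f) (j : ℕ) :
    f^[j] y ∈ recurrentPts f := by
  refine mem_recurrentPts_of_exists_return fun N hN k => ?_
  obtain ⟨n, hkn, hn⟩ := exists_iterate_mem_of_recurrent hy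
    ((hf.iterate j).continuousAt.preimage_mem_nhds hN) k
  refine ⟨n, hkn, ?_⟩
  rwa [mem_preimage, ← iterate_add_apply, Nat.add_comm, iterate_add_apply] at hn

lemma periodicPts_subset_recurrentPts : periodicPts f ⊆ recurrentPts f := by
  rintro x ⟨m, hm, hx⟩
  refine mem_recurrentPts_of_exists_return fun N hN k => ⟨m * k, Nat.le_mul_of_pos_left k hm, ?_⟩
  rw [(hx.mul_const k).eq]
  exact mem_of_mem_nhds hN

lemma mem_periodicPts_of_recurrent_of_evPeriodic {x : G} (hr : x ∈ recurrentPts f)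
    (he : x ∈ evPeriodicPts f) : x ∈ periodicPts f := by
  obtain ⟨k, hk⟩ := exists_iterate_mem_periodicPts he
  by_contra hx
  have hfin : (range (fun n : ℕ => f^[n] x) \ {x}).Finite := Set.Finite.subset he sdiff_subset
  obtain ⟨n, hkn, hn⟩ := exists_iterate_mem_of_recurrent hr
    (hfin.isClosed.isOpen_compl.mem_nhds (by simp)) (k + 1)
  have hpn := hk n (by omega)
  have : f^[n] x = x := by
    by_contra hne
    exact hn ⟨⟨n, rfl⟩, hne⟩
  exact hx (this ▸ hpn)

lemma iterate_mem_closure_periodicPts (hf : Continuous f) {x : G}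
    (hx : x ∈ closure (periodicPts f)) (j : ℕ) : f^[j] x ∈ closure (periodicPts f) :=
  map_mem_closure (hf.iterate j) hx fun _ hp => iterate_mem_periodicPts hp j

lemma exists_iterate_notMem_nhds {x : G} (hr : x ∉ recurrentPts f) :
    ∃ N ∈ 𝓝 x, ∃ k, ∀ n ≥ k, f^[n] x ∉ N := by
  by_contra! h
  exact hr (mem_recurrentPts_of_exists_return h)

end Recurrence

section ArcRecurrence

variable {G : Type*} [MetricSpace G] {f : G → G} {φ : ℝ → G} {a b : ℝ}

/-- An arc with open interior and without periodic points whose initial point eventually stays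
outside the interior of the arc has no recurrent point in its interior. -/
lemma notMem_recurrentPts_of_arc (hf : Continuous f) (hφ : ContinuousOn φ (Icc a b))
    (hinj : InjOn φ (Icc a b)) (hO : ∀ c d, a ≤ c → d ≤ b → IsOpen (φ '' Ioo c d))
    (hper : ∀ t ∈ Icc a b, φ t ∉ periodicPts f) {k : ℕ}
    (hk : ∀ n ≥ k, f^[n] (φ a) ∉ φ '' Ioo a b) {τ : ℝ} (hτ : τ ∈ Ioo a b) :
    φ τ ∉ recurrentPts f := by
  intro hrec
  have nofix : ∀ n, 0 < n → ∀ t ∈ Icc a b, f^[n] (φ t) ≠ φ t :=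
    fun n hn t ht e => hper t ht ⟨n, hn, e⟩
  -- returns realizing the order pattern `high, low, middle` are impossible
  have core : ∀ τ₀ τ₁ τ₂ : ℝ, τ₀ < b → a < τ₁ → τ₁ < τ₂ → τ₂ < τ₀ → ∀ n₁ n₂ : ℕ,
      k + 1 ≤ n₁ → k + 1 ≤ n₂ → f^[n₁] (φ τ₀) = φ τ₁ → f^[n₂] (φ τ₁) = φ τ₂ → False := by
    intro τ₀ τ₁ τ₂ h₀ h₁ h₁₂ h₂₀ n₁ n₂ hn₁ hn₂ e₁ e₂
    obtain ⟨t, ht, e | e | e⟩ := exists_fixed_of_returns hφ hinj (hO a b le_rfl le_rfl)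
      (hf.iterate n₁) (hf.iterate n₂) (hk n₁ (by omega)) (hk n₂ (by omega)) h₀ h₁ h₁₂ h₂₀ e₁ e₂
    · exact nofix n₁ (by omega) t ht e
    · exact nofix n₂ (by omega) t ht e
    · exact nofix (n₂ + n₁) (by omega) t ht (by rw [iterate_add_apply]; exact e)
  have noBelow : ∀ σ ∈ Ioo a b, ¬ ∀ c ∈ Ico a σ, ∀ m : ℕ, ∃ n ≥ m, ∃ σ' ∈ Ioo c σ,
      f^[n] (φ σ) = φ σ' := by
    intro σ hσ h
    obtain ⟨n₁, hn₁, σ₁, hσ₁, e₁⟩ := h a ⟨le_rfl, hσ.1⟩ (k + 1)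
    obtain ⟨n₂, hn₂, σ₂, hσ₂, e₂⟩ := h σ₁ ⟨hσ₁.1.le, hσ₁.2⟩ (n₁ + (k + 1))
    refine core σ σ₁ σ₂ hσ.2 hσ₁.1 hσ₂.1 hσ₂.2 n₁ (n₂ - n₁) hn₁ (by omega) e₁ ?_
    rw [← e₁, ← iterate_add_apply, Nat.sub_add_cancel (by omega), e₂]
  have above : ∀ σ ∈ Ioo a b, φ σ ∈ recurrentPts f → ∀ d ∈ Ioc σ b, ∀ m : ℕ,
      ∃ n ≥ m, ∃ σ' ∈ Ioo σ d, f^[n] (φ σ) = φ σ' := by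
    intro σ hσ hr d hd m
    have hnb := noBelow σ hσ
    push Not at hnb
    obtain ⟨c, hc, m', hm'⟩ := hnb
    obtain ⟨n, hn, σ', hσ', e⟩ := exists_iterate_mem_of_recurrent hr
      ((hO c d hc.1 hd.2).mem_nhds (mem_image_of_mem φ ⟨hc.2, hd.1⟩)) (max (max m m') 1)
    simp only [max_le_iff] at hn
    refine ⟨n, hn.1.1, σ', ⟨?_, hσ'.2⟩, e.symm⟩
    rcases lt_trichotomy σ σ' with h | rfl | h
    · exact h
    · exact absurd e.symm (nofix n (by omega) σ (Ioo_subset_Icc_self hσ))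
    · exact absurd e.symm (hm' n hn.1.2 σ' ⟨hσ'.1, h⟩)
  obtain ⟨n₀, -, σ₀, hσ₀, e₀⟩ := above τ hτ hrec b ⟨hτ.2, le_rfl⟩ 0
  obtain ⟨n₁, hn₁, σ₁, hσ₁, e₁⟩ := above τ hτ hrec σ₀ ⟨hσ₀.1, hσ₀.2.le⟩ (n₀ + (k + 1))
  have hσ₁m : σ₁ ∈ Ioo a b := ⟨hτ.1.trans hσ₁.1, hσ₁.2.trans hσ₀.2⟩
  obtain ⟨n₂, hn₂, σ₂, hσ₂, e₂⟩ := above σ₁ hσ₁m (e₁ ▸ iterate_mem_recurrentPts hf hrec n₁) σ₀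
    ⟨hσ₁.2, hσ₀.2.le⟩ (k + 1)
  refine core σ₀ σ₁ σ₂ hσ₀.2 hσ₁m.1 hσ₂.1 hσ₂.2 (n₁ - n₀) n₂ (by omega) hn₂ ?_ e₂
  rw [← e₀, ← iterate_add_apply, Nat.sub_add_cancel (by omega), e₁]

end ArcRecurrence

section Graph

variable {G : Type*} [MetricSpace G] {V A B : Set G} {φ : ℝ → G}

lemma isCircle_image_of_loop {γ : ℝ → G} (hγ : ContinuousOn γ (Icc 0 1)) (h01 : γ 0 = γ 1)
    (hinj : InjOn γ (Ico 0 1)) : IsCircle (γ '' Icc 0 1) := by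
  have hrep : ∀ p : AddCircle (1 : ℝ), ∃ t ∈ Ico (0 : ℝ) 1, (t : AddCircle (1 : ℝ)) = p := by
    intro p
    obtain ⟨t, ht, e⟩ := AddCircle.eq_coe_Ico p
    exact ⟨t, ht, e⟩
  set F : AddCircle (1 : ℝ) → G := AddCircle.liftIco 1 0 γ with hF
  have hFt : ∀ t ∈ Ico (0 : ℝ) 1, F t = γ t := fun t ht => AddCircle.liftIco_zero_coe_apply ht
  have hFc : Continuous F := AddCircle.liftIco_zero_continuous h01 hγ
  have hFi : Injective F := by
    intro p q hpq
    obtain ⟨s, hs, rfl⟩ := hrep p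
    obtain ⟨t, ht, rfl⟩ := hrep q
    rw [hFt s hs, hFt t ht] at hpq
    rw [hinj hs ht hpq]
  have hrange : range F = γ '' Icc 0 1 := by
    ext p
    constructor
    · rintro ⟨q, rfl⟩
      obtain ⟨s, hs, rfl⟩ := hrep q
      exact ⟨s, Ico_subset_Icc_self hs, (hFt s hs).symm⟩
    · rintro ⟨s, hs, rfl⟩
      rcases eq_or_lt_of_le hs.2 with rfl | h
      · exact ⟨((0 : ℝ) : AddCircle (1 : ℝ)), by rw [hFt 0 (by simp), h01]⟩
      · exact ⟨s, hFt s ⟨hs.1, h⟩⟩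
  rw [← hrange]
  have eC : Circle ≃ₜ Metric.sphere (0 : ℂ) 1 := Homeomorph.refl (Metric.sphere (0 : ℂ) 1)
  exact ⟨((hFc.isClosedEmbedding hFi).isEmbedding.toHomeomorph.symm.trans
    (AddCircle.homeomorphCircle one_ne_zero)).trans eC⟩

/-- Two arcs with common endpoints and otherwise disjoint form a circle. -/
lemma isCircle_union_of_arcs {α β : ℝ → G} (hα : ContinuousOn α (Icc 0 1))
    (hβ : ContinuousOn β (Icc 0 1)) (hαi : InjOn α (Icc 0 1)) (hβi : InjOn β (Icc 0 1))
    (h0 : α 0 = β 0) (h1 : α 1 = β 1) (hd : ∀ s ∈ Icc (0 : ℝ) 1, ∀ t ∈ Ioo (0 : ℝ) 1, α s ≠ β t) :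
    IsCircle (α '' Icc 0 1 ∪ β '' Icc 0 1) := by
  set γ : ℝ → G := fun t => if t ≤ 1 / 2 then α (2 * t) else β (2 - 2 * t) with hγ
  have hγα : ∀ t ≤ 1 / 2, γ t = α (2 * t) := fun t ht => if_pos ht
  have hγβ : ∀ t, 1 / 2 ≤ t → γ t = β (2 - 2 * t) := by
    intro t ht
    rcases eq_or_lt_of_le ht with rfl | h
    · rw [hγα _ le_rfl]; norm_num [h1]
    · exact if_neg (not_le.2 h)
  have hunion : Icc (0 : ℝ) 1 = Icc 0 (1 / 2) ∪ Icc (1 / 2) 1 :=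
    (Icc_union_Icc_eq_Icc (by norm_num) (by norm_num)).symm
  have hcont : ContinuousOn γ (Icc 0 1) := by
    rw [hunion]
    refine ContinuousOn.union_of_isClosed ?_ ?_ isClosed_Icc isClosed_Icc
    · refine (hα.comp (f := fun t : ℝ => 2 * t) (by fun_prop) ?_).congr fun t ht => hγα t ht.2
      intro t ht
      exact ⟨by linarith [ht.1], by linarith [ht.2]⟩
    · refine (hβ.comp (f := fun t : ℝ => 2 - 2 * t) (by fun_prop) ?_).congr
        fun t ht => hγβ t ht.1
      intro t ht
      exact ⟨by linarith [ht.2], by linarith [ht.1]⟩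
  have hends : γ 0 = γ 1 := by
    rw [hγα 0 (by norm_num), hγβ 1 (by norm_num)]
    norm_num [h0]
  have hinj : InjOn γ (Ico 0 1) := by
    intro s hs t ht hst
    have key : ∀ s ∈ Ico (0 : ℝ) 1, ∀ t ∈ Ico (0 : ℝ) 1, s ≤ 1 / 2 → ¬ t ≤ 1 / 2 → γ s ≠ γ t := by
      intro s hs t ht h h'
      rw [hγα s h, hγβ t (not_le.1 h').le]
      exact hd _ ⟨by linarith [hs.1], by linarith⟩ _ ⟨by linarith [ht.2], by linarith⟩
    by_cases h : s ≤ 1 / 2 <;> by_cases h' : t ≤ 1 / 2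
    · rw [hγα s h, hγα t h'] at hst
      have := hαi ⟨by linarith [hs.1], by linarith⟩ ⟨by linarith [ht.1], by linarith⟩ hst
      linarith
    · exact absurd hst (key s hs t ht h h')
    · exact absurd hst.symm (key t ht s hs h' h)
    · have h2 := (not_le.1 h).le
      have h2' := (not_le.1 h').le
      rw [hγβ s h2, hγβ t h2'] at hst
      have := hβi ⟨by linarith [hs.2], by linarith⟩ ⟨by linarith [ht.2], by linarith⟩ hst
      linarith
  have himage : γ '' Icc 0 1 = α '' Icc 0 1 ∪ β '' Icc 0 1 := by
    rw [hunion, image_union, ← hunion]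
    congr 1
    · ext p
      constructor
      · rintro ⟨t, ht, rfl⟩
        exact ⟨2 * t, ⟨by linarith [ht.1], by linarith [ht.2]⟩, (hγα t ht.2).symm⟩
      · rintro ⟨t, ht, rfl⟩
        refine ⟨t / 2, ⟨by linarith [ht.1], by linarith [ht.2]⟩, ?_⟩
        rw [hγα _ (by linarith [ht.2])]
        congr 1; ring
    · ext p
      constructor
      · rintro ⟨t, ht, rfl⟩
        exact ⟨2 - 2 * t, ⟨by linarith [ht.2], by linarith [ht.1]⟩, (hγβ t ht.1).symm⟩
      · rintro ⟨t, ht, rfl⟩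
        refine ⟨1 - t / 2, ⟨by linarith [ht.2], by linarith [ht.1]⟩, ?_⟩
        rw [hγβ _ (by linarith [ht.2])]
        congr 1; ring
  rw [← himage]
  exact isCircle_image_of_loop hcont hends hinj

lemma closure_connectedComponentIn_compl_subset (x : G) :
    closure (connectedComponentIn Vᶜ x) ⊆ connectedComponentIn Vᶜ x ∪ V := by
  by_cases hx : x ∈ Vᶜ
  · intro p hp
    by_cases hpV : p ∈ V
    · exact Or.inr hpV
    left
    have hpre : IsPreconnected (insert p (connectedComponentIn Vᶜ x)) :=
      isPreconnected_connectedComponentIn.subset_closure (subset_insert _ _)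
        (insert_subset hp subset_closure)
    exact hpre.subset_connectedComponentIn (mem_insert_of_mem _ (mem_connectedComponentIn hx))
      (insert_subset hpV (connectedComponentIn_subset _ _)) (mem_insert _ _)
  · simp [connectedComponentIn_eq_empty hx]

/-- An end of an open arc whose closure adds only finitely many points converges. -/
lemma exists_tendsto_of_end [CompactSpace G] (hV : V.Finite) (hA : closure A ⊆ A ∪ V)
    (e : A ≃ₜ Ioo (0 : ℝ) 1) {g : ℝ → G} (hg : ∀ t (ht : t ∈ Ioo (0 : ℝ) 1), g t = e.symm ⟨t, ht⟩)
    {l : Filter ℝ} [NeBot l] (hl : Ioo (0 : ℝ) 1 ∈ l)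
    (hleave : ∀ s ∈ Ioo (0 : ℝ) 1, ∃ W, IsOpen W ∧ s ∈ W ∧ Wᶜ ∈ l)
    (hconn : ∀ s ∈ l, ∃ t ∈ l, t ⊆ s ∧ IsPreconnected t) : ∃ v ∈ V, Tendsto g l (𝓝 v) := by
  have hgA : ∀ t ∈ Ioo (0 : ℝ) 1, g t ∈ A := fun t ht => by rw [hg t ht]; exact Subtype.coe_prop _
  have hgc : ContinuousOn g (Ioo 0 1) := by
    rw [continuousOn_iff_continuous_domRestrict]
    have : (Ioo (0 : ℝ) 1).domRestrict g = fun t => (e.symm t : G) := by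
      ext t
      exact hg t t.2
    rw [this]
    exact continuous_subtype_val.comp e.symm.continuous
  have hclus : ∀ p, MapClusterPt p l g → p ∈ V := by
    intro p hp
    have hpA : p ∈ closure A :=
      mem_closure_iff_clusterPt.2 (hp.clusterPt.mono
        (le_principal_iff.2 (mem_map.2 (mem_of_superset hl hgA))))
    refine (hA hpA).resolve_left fun hmem => ?_
    obtain ⟨W, hW, hsW, hWl⟩ := hleave (e ⟨p, hmem⟩) (e ⟨p, hmem⟩).2
    obtain ⟨N, hN, hNU⟩ := isOpen_induced_iff.1
      (hW.preimage (continuous_subtype_val.comp e.continuous))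
    have hpN : p ∈ N := by
      have : (⟨p, hmem⟩ : A) ∈ Subtype.val ⁻¹' N := by rw [hNU]; exact hsW
      exact this
    obtain ⟨t, htN, htI, htW⟩ :=
      ((hp.frequently (hN.mem_nhds hpN)).and_eventually (inter_mem hl hWl)).exists
    have : (e.symm ⟨t, htI⟩ : A) ∈ Subtype.val ⁻¹' N := by
      rw [mem_preimage, ← hg t htI]; exact htN
    rw [hNU] at this
    exact htW (by simpa using this)
  obtain ⟨v, hv⟩ := exists_clusterPt_of_compactSpace (map g l)
  have hvV : v ∈ V := hclus v hv
  refine ⟨v, hvV, ?_⟩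
  rw [tendsto_def]
  intro O hO
  obtain ⟨O', hO'O, hO', hvO'⟩ := _root_.mem_nhds_iff.1 hO
  obtain ⟨M, N, hM, hN, hvM, hVN, hMN⟩ := SeparatedNhds.of_isCompact_isClosed
    (isCompact_singleton (x := v)) (hV.subset (sdiff_subset (t := {v}))).isClosed
    disjoint_sdiff_right
  have hvM' : v ∈ M ∩ O' := ⟨hvM rfl, hvO'⟩
  have hev : (M ∩ O') ∪ N ∈ map g l := by
    refine isCompact_univ.adherence_nhdset (by simp) ((hM.inter hO').union hN) fun p _ hp => ?_
    by_cases hpv : p = v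
    · exact Or.inl (hpv ▸ hvM')
    · exact Or.inr (hVN ⟨hclus p hp, hpv⟩)
  obtain ⟨t, htl, hts, htc⟩ := hconn _ (inter_mem hl hev)
  have himc : IsPreconnected (g '' t) := htc.image g (hgc.mono fun s hs => (hts hs).1)
  have hmeet : (g '' t ∩ (M ∩ O')).Nonempty := by
    obtain ⟨s, hs, hst⟩ :=
      ((MapClusterPt.frequently hv ((hM.inter hO').mem_nhds hvM')).and_eventually
      htl).exists
    exact ⟨g s, mem_image_of_mem g hst, hs⟩
  have hsub : g '' t ⊆ M ∩ O' := himc.subset_left_of_subset_union (hM.inter hO') hN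
    (hMN.mono_left inter_subset_left) (image_subset_iff.2 fun s hs => (hts hs).2) hmeet
  exact mem_of_superset htl fun s hs => hO'O (hsub (mem_image_of_mem g hs)).2

/-- `φ` parametrizes the closure of the open edge `A`, with endpoints in the vertex set `V`. -/
structure IsEdgeParam (V A : Set G) (φ : ℝ → G) : Prop where
  continuousOn : ContinuousOn φ (Icc 0 1)
  injOn : InjOn φ (Icc 0 1)
  image_Ioo : φ '' Ioo 0 1 = A
  zero_mem : φ 0 ∈ V
  one_mem : φ 1 ∈ V

lemma Icc_zero_one_eq : Icc (0 : ℝ) 1 = insert 0 (insert 1 (Ioo 0 1)) := by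
  ext t
  simp only [mem_Icc, mem_insert_iff, mem_Ioo]
  constructor
  · rintro ⟨h0, h1⟩
    rcases eq_or_lt_of_le h0 with h | h
    · exact Or.inl h.symm
    rcases eq_or_lt_of_le h1 with h' | h'
    · exact Or.inr (Or.inl h')
    · exact Or.inr (Or.inr ⟨h, h'⟩)
  · rintro (rfl | rfl | ⟨h, h'⟩)
    · simp
    · simp
    · exact ⟨h.le, h'.le⟩

lemma exists_isEdgeParam (hG : IsTopGraph V) {x : G} (hx : x ∈ Vᶜ) :
    ∃ φ, IsEdgeParam V (connectedComponentIn Vᶜ x) φ := by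
  have := hG.compact
  obtain ⟨e⟩ := hG.component_openArc x hx
  set A := connectedComponentIn Vᶜ x with hAdef
  have hAV : ∀ p ∈ A, p ∉ V := fun p hp => connectedComponentIn_subset _ _ hp
  have hcl : closure A ⊆ A ∪ V := closure_connectedComponentIn_compl_subset x
  classical
  set g : ℝ → G := fun t => if ht : t ∈ Ioo (0 : ℝ) 1 then (e.symm ⟨t, ht⟩ : G) else x with hgdef
  have hg : ∀ t (ht : t ∈ Ioo (0 : ℝ) 1), g t = e.symm ⟨t, ht⟩ := fun t ht => dif_pos ht
  have hgc : ContinuousOn g (Ioo 0 1) := by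
    rw [continuousOn_iff_continuous_domRestrict]
    have : (Ioo (0 : ℝ) 1).domRestrict g = fun t => (e.symm t : G) := by
      ext t
      exact hg t t.2
    rw [this]
    exact continuous_subtype_val.comp e.symm.continuous
  obtain ⟨u, huV, hu⟩ := exists_tendsto_of_end (l := 𝓝[>] (0 : ℝ)) hG.finite_vertexSet hcl e hg
    (Ioo_mem_nhdsGT one_pos)
    (fun s hs => ⟨Ioi (s / 2), isOpen_Ioi, by simp [hs.1],
      mem_of_superset (Ioo_mem_nhdsGT (half_pos hs.1)) fun t ht => by simpa using ht.2.le⟩)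
    (fun s hs => by
      obtain ⟨c, hc, h⟩ := (nhdsGT_basis (0 : ℝ)).mem_iff.1 hs
      exact ⟨Ioo 0 c, Ioo_mem_nhdsGT hc, h, isPreconnected_Ioo⟩)
  obtain ⟨v, hvV, hv⟩ := exists_tendsto_of_end (l := 𝓝[<] (1 : ℝ)) hG.finite_vertexSet hcl e hg
    (Ioo_mem_nhdsLT one_pos)
    (fun s hs => ⟨Iio ((s + 1) / 2), isOpen_Iio, by simp only [mem_Iio]; linarith [hs.2],
      mem_of_superset (Ioo_mem_nhdsLT (show (s + 1) / 2 < 1 by linarith [hs.2]))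
        fun t ht => by simpa using ht.1.le⟩)
    (fun s hs => by
      obtain ⟨c, hc, h⟩ := (nhdsLT_basis (1 : ℝ)).mem_iff.1 hs
      exact ⟨Ioo c 1, Ioo_mem_nhdsLT hc, h, isPreconnected_Ioo⟩)
  set φ := extendFrom (Ioo (0 : ℝ) 1) g with hφdef
  have hφc : ContinuousOn φ (Icc 0 1) := continuousOn_Icc_extendFrom_Ioo hgc hu hv
  have hφ0 : φ 0 = u := eq_lim_at_left_extendFrom_Ioo one_pos hu
  have hφ1 : φ 1 = v := eq_lim_at_right_extendFrom_Ioo one_pos hv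
  have hφt : ∀ t (ht : t ∈ Ioo (0 : ℝ) 1), φ t = e.symm ⟨t, ht⟩ := fun t ht =>
    (extendFrom_extends hgc t ht).trans (hg t ht)
  have him : φ '' Ioo 0 1 = A := by
    ext p
    constructor
    · rintro ⟨t, ht, rfl⟩
      rw [hφt t ht]
      exact Subtype.coe_prop _
    · intro hp
      exact ⟨e ⟨p, hp⟩, (e ⟨p, hp⟩).2, by rw [hφt _ (e ⟨p, hp⟩).2]; simp⟩
  have hinj : InjOn φ (Ioo 0 1) := by
    intro s hs t ht h
    rw [hφt s hs, hφt t ht] at h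
    simpa using e.symm.injective (Subtype.ext h)
  have hne : ∀ t ∈ Ioo (0 : ℝ) 1, φ t ∉ V := fun t ht =>
    hAV _ (him ▸ mem_image_of_mem φ ht)
  have huv : u ≠ v := by
    intro huv
    have hC : IsCircle (φ '' Icc 0 1) := by
      refine isCircle_image_of_loop hφc (by rw [hφ0, hφ1, huv]) ?_
      rw [← Ioo_insert_left one_pos, injOn_insert (by simp)]
      refine ⟨hinj, ?_⟩
      rintro ⟨t, ht, h⟩
      exact hne t ht (by rw [h, hφ0]; exact huV)
    have h3 := hG.circle_vertices _ hC
    have hsub : φ '' Icc 0 1 ∩ V ⊆ {u} := by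
      rintro _ ⟨⟨t, ht, rfl⟩, hV⟩
      rw [Icc_zero_one_eq] at ht
      rcases ht with rfl | rfl | ht
      · exact hφ0
      · exact hφ1.trans huv.symm
      · exact absurd hV (hne t ht)
    have := ncard_le_ncard hsub
    rw [ncard_singleton] at this
    omega
  refine ⟨φ, hφc, ?_, him, hφ0 ▸ huV, hφ1 ▸ hvV⟩
  rw [Icc_zero_one_eq, injOn_insert (by simp), injOn_insert (by simp), image_insert_eq]
  refine ⟨⟨hinj, ?_⟩, ?_⟩
  · rintro ⟨t, ht, h⟩
    exact hne t ht (by rw [h, hφ1]; exact hvV)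
  · rintro (h | ⟨t, ht, h⟩)
    · exact huv (by rw [← hφ0, ← hφ1, h])
    · exact hne t ht (by rw [h, hφ0]; exact huV)

lemma IsEdgeParam.notMem_of_mem_Ioo (h : IsEdgeParam V A φ) (hA : A ⊆ Vᶜ) {t : ℝ}
    (ht : t ∈ Ioo (0 : ℝ) 1) : φ t ∉ V :=
  hA (h.image_Ioo ▸ mem_image_of_mem φ ht)

lemma IsTopGraph.eq_of_endpoints_eq (hG : IsTopGraph V) {α β : ℝ → G} (hα : IsEdgeParam V A α)
    (hβ : IsEdgeParam V B β) (hA : A ⊆ Vᶜ) (hB : B ⊆ Vᶜ) (h0 : α 0 = β 0) (h1 : α 1 = β 1) :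
    ¬ Disjoint A B := by
  intro hd
  have hC := isCircle_union_of_arcs hα.continuousOn hβ.continuousOn hα.injOn hβ.injOn h0 h1 (by
    intro s hs t ht h
    have hβt : β t ∈ B := hβ.image_Ioo ▸ mem_image_of_mem β ht
    rw [Icc_zero_one_eq] at hs
    rcases hs with rfl | rfl | hs
    · exact hB hβt (h ▸ hα.zero_mem)
    · exact hB hβt (h ▸ hα.one_mem)
    · exact disjoint_left.1 hd (hα.image_Ioo ▸ mem_image_of_mem α hs) (h ▸ hβt))
  have h3 := hG.circle_vertices _ hC
  have hsub : (α '' Icc 0 1 ∪ β '' Icc 0 1) ∩ V ⊆ {α 0, α 1} := by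
    rintro _ ⟨⟨t, ht, rfl⟩ | ⟨t, ht, rfl⟩, hV⟩ <;> rw [Icc_zero_one_eq] at ht <;>
      rcases ht with rfl | rfl | ht
    · exact Or.inl rfl
    · exact Or.inr rfl
    · exact absurd hV (hα.notMem_of_mem_Ioo hA ht)
    · exact Or.inl h0.symm
    · exact Or.inr h1.symm
    · exact absurd hV (hβ.notMem_of_mem_Ioo hB ht)
  have := (ncard_le_ncard hsub (by simp)).trans (ncard_insert_le _ _)
  rw [ncard_singleton] at this
  omega

/-- A graph has finitely many open edges. -/
lemma IsTopGraph.finite_components (hG : IsTopGraph V) :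
    (connectedComponentIn Vᶜ '' Vᶜ).Finite := by
  have := hG.nontrivial
  choose! φ hφ using fun x (hx : x ∈ Vᶜ) => exists_isEdgeParam hG hx
  have hfin : ((fun x => (φ x 0, φ x 1)) '' Vᶜ).Finite := by
    refine (hG.finite_vertexSet.prod hG.finite_vertexSet).subset ?_
    rintro _ ⟨x, hx, rfl⟩
    exact ⟨(hφ x hx).zero_mem, (hφ x hx).one_mem⟩
  have hrep : ∀ q ∈ (fun x => (φ x 0, φ x 1)) '' Vᶜ, ∃ x ∈ Vᶜ, (φ x 0, φ x 1) = q := fun _ h => h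
  choose! r hr hrq using hrep
  refine (hfin.image fun q => connectedComponentIn Vᶜ (r q)).subset ?_
  rintro _ ⟨x, hx, rfl⟩
  have hq := mem_image_of_mem (fun x => (φ x 0, φ x 1)) hx
  refine ⟨_, hq, ?_⟩
  have hends := Prod.ext_iff.1 (hrq _ hq)
  have hnd := hG.eq_of_endpoints_eq (hφ _ (hr _ hq)) (hφ x hx) (connectedComponentIn_subset _ _)
    (connectedComponentIn_subset _ _) hends.1 hends.2
  obtain ⟨p, hp, hp'⟩ := not_disjoint_iff.1 hnd
  exact (connectedComponentIn_eq hp).trans (connectedComponentIn_eq hp').symm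

lemma IsTopGraph.isOpen_component (hG : IsTopGraph V) (x : G) :
    IsOpen (connectedComponentIn Vᶜ x) := by
  have hfin : ((connectedComponentIn Vᶜ '' Vᶜ) \ {connectedComponentIn Vᶜ x}).Finite :=
    hG.finite_components.subset sdiff_subset
  have hcl : IsClosed (V ∪ ⋃ C ∈ (connectedComponentIn Vᶜ '' Vᶜ) \ {connectedComponentIn Vᶜ x},
      closure C) :=
    hG.finite_vertexSet.isClosed.union (hfin.isClosed_biUnion fun _ _ => isClosed_closure)
  convert hcl.isOpen_compl using 1
  ext p
  simp only [mem_compl_iff, mem_union, mem_iUnion, not_or, not_exists]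
  constructor
  · intro hp
    refine ⟨connectedComponentIn_subset _ _ hp, ?_⟩
    rintro _ ⟨⟨y, hy, rfl⟩, hne⟩ hpc
    rcases closure_connectedComponentIn_compl_subset y hpc with h | h
    · exact hne ((connectedComponentIn_eq h).trans (connectedComponentIn_eq hp).symm)
    · exact connectedComponentIn_subset _ _ hp h
  · rintro ⟨hpV, h⟩
    by_contra hp
    refine h (connectedComponentIn Vᶜ p) ⟨mem_image_of_mem _ hpV, fun he => hp ?_⟩
      (subset_closure (mem_connectedComponentIn hpV))
    rw [← mem_singleton_iff.1 he]
    exact mem_connectedComponentIn hpV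

lemma IsEdgeParam.isOpen_image_Ioo (h : IsEdgeParam V A φ) (hA : IsOpen A) {c d : ℝ}
    (hc : 0 ≤ c) (hd : d ≤ 1) : IsOpen (φ '' Ioo c d) := by
  have hsub : Icc (0 : ℝ) 1 \ Ioo c d ⊆ Icc 0 1 := sdiff_subset
  have hK : IsClosed (φ '' (Icc 0 1 \ Ioo c d)) :=
    ((isCompact_Icc.diff isOpen_Ioo).image_of_continuousOn (h.continuousOn.mono hsub)).isClosed
  convert hA.inter hK.isOpen_compl using 1
  ext p
  constructor
  · rintro ⟨t, ht, rfl⟩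
    have ht' : t ∈ Ioo (0 : ℝ) 1 := ⟨hc.trans_lt ht.1, ht.2.trans_le hd⟩
    refine ⟨h.image_Ioo ▸ mem_image_of_mem φ ht', ?_⟩
    rintro ⟨s, hs, e⟩
    exact hs.2 (h.injOn hs.1 (Ioo_subset_Icc_self ht') e ▸ ht)
  · rintro ⟨hp, hn⟩
    rw [← h.image_Ioo] at hp
    obtain ⟨t, ht, rfl⟩ := hp
    by_contra hnt
    exact hn ⟨t, ⟨Ioo_subset_Icc_self ht, fun h' => hnt ⟨t, h', rfl⟩⟩, rfl⟩

lemma IsEdgeParam.closure_subset (h : IsEdgeParam V A φ) : closure A ⊆ φ '' Icc 0 1 :=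
  closure_minimal (h.image_Ioo ▸ image_mono Ioo_subset_Icc_self)
    (isCompact_Icc.image_of_continuousOn h.continuousOn).isClosed

lemma IsEdgeParam.flip (h : IsEdgeParam V A φ) : IsEdgeParam V A fun t => φ (1 - t) where
  continuousOn := h.continuousOn.comp (f := fun t : ℝ => 1 - t) (by fun_prop)
    fun t ht => ⟨by linarith [ht.2], by linarith [ht.1]⟩
  injOn := by
    intro s hs t ht e
    have := h.injOn (x₁ := 1 - s) (x₂ := 1 - t) ⟨by linarith [hs.2], by linarith [hs.1]⟩
      ⟨by linarith [ht.2], by linarith [ht.1]⟩ e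
    linarith
  image_Ioo := by
    rw [← h.image_Ioo]
    ext p
    constructor
    · rintro ⟨t, ht, rfl⟩
      exact ⟨1 - t, ⟨by linarith [ht.2], by linarith [ht.1]⟩, rfl⟩
    · rintro ⟨t, ht, rfl⟩
      exact ⟨1 - t, ⟨by linarith [ht.2], by linarith [ht.1]⟩, by simp⟩
  zero_mem := by simpa using h.one_mem
  one_mem := by simpa using h.zero_mem

end Graph

section GraphMap

variable {G : Type*} [MetricSpace G] {f : G → G} {V A W : Set G} {φ : ℝ → G}

/-- Points of an edge that accumulate at `φ s` do so along the edge. -/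
lemma IsEdgeParam.exists_uIcc_subset (h : IsEdgeParam V A φ) {S : Set G} {s : ℝ}
    (hs : s ∈ Icc (0 : ℝ) 1) (hcl : φ s ∈ closure (A ∩ S)) (hW : W ∈ 𝓝 (φ s)) :
    ∃ t ∈ Ioo (0 : ℝ) 1, φ t ∈ S ∧ ∀ r ∈ uIcc s t, φ r ∈ W := by
  obtain ⟨δ, hδ, hball⟩ := mem_nhdsWithin_iff.1 (h.continuousOn s hs hW)
  have hK : IsClosed (φ '' (Icc 0 1 \ ball s δ)) :=
    ((isCompact_Icc.diff isOpen_ball).image_of_continuousOn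
      (h.continuousOn.mono sdiff_subset)).isClosed
  have hsK : φ s ∉ φ '' (Icc 0 1 \ ball s δ) := by
    rintro ⟨t, ht, e⟩
    exact ht.2 (h.injOn ht.1 hs e ▸ mem_ball_self hδ)
  obtain ⟨p, hpK, hpA, hpS⟩ := mem_closure_iff_nhds.1 hcl _ (hK.isOpen_compl.mem_nhds hsK)
  rw [← h.image_Ioo] at hpA
  obtain ⟨t, ht, rfl⟩ := hpA
  have htI := Ioo_subset_Icc_self ht
  have htδ : t ∈ ball s δ := by
    by_contra hn
    exact hpK ⟨t, ⟨htI, hn⟩, rfl⟩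
  exact ⟨t, ht, hpS, fun r hr => hball
    ⟨(convex_ball s δ).ordConnected.uIcc_subset (mem_ball_self hδ) htδ hr,
      ordConnected_Icc.uIcc_subset hs htI hr⟩⟩

lemma IsEdgeParam.notMem_recurrentPts_of_lt (h : IsEdgeParam V A φ) (hf : Continuous f)
    (hA : IsOpen A) (hW : IsOpen W) (hper : Disjoint W (periodicPts f)) {s t : ℝ} (hs : 0 ≤ s)
    (hst : s < t) (ht : t < 1) (hsub : ∀ r ∈ Icc s t, φ r ∈ W) {k : ℕ}
    (hk : ∀ n ≥ k, f^[n] (φ s) ∉ W) : φ t ∉ recurrentPts f := by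
  have htI : t ∈ Icc (0 : ℝ) 1 := ⟨hs.trans hst.le, ht.le⟩
  obtain ⟨δ, hδ, hball⟩ := mem_nhdsWithin_iff.1
    (h.continuousOn t htI (hW.mem_nhds (hsub t (right_mem_Icc.2 hst.le))))
  set b := min 1 (t + δ / 2) with hb
  have htb : t < b := lt_min ht (by linarith)
  have hb1 : b ≤ 1 := min_le_left _ _
  have hbδ : b ≤ t + δ / 2 := min_le_right _ _
  have hI : Icc s b ⊆ Icc 0 1 := Icc_subset_Icc hs hb1
  have hIW : ∀ r ∈ Icc s b, φ r ∈ W := by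
    intro r hr
    rcases le_or_gt r t with hrt | hrt
    · exact hsub r ⟨hr.1, hrt⟩
    · refine hball ⟨?_, hI hr⟩
      rw [Metric.mem_ball, Real.dist_eq, abs_lt]
      constructor <;> linarith [hr.2]
  exact notMem_recurrentPts_of_arc hf (h.continuousOn.mono hI) (h.injOn.mono hI)
    (fun c d hc hd => h.isOpen_image_Ioo hA (hs.trans hc) (hd.trans hb1))
    (fun r hr => disjoint_left.1 hper (hIW r hr)) (k := k)
    (fun n hn hmem => by
      obtain ⟨r, hr, e⟩ := hmem
      exact hk n hn (e ▸ hIW r (Ioo_subset_Icc_self hr)))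
    ⟨hst, htb⟩

lemma IsEdgeParam.notMem_recurrentPts (h : IsEdgeParam V A φ) (hf : Continuous f)
    (hA : IsOpen A) (hW : IsOpen W) (hper : Disjoint W (periodicPts f)) {s t : ℝ}
    (hs : s ∈ Icc (0 : ℝ) 1) (ht : t ∈ Ioo (0 : ℝ) 1) (hst : s ≠ t)
    (hsub : ∀ r ∈ uIcc s t, φ r ∈ W) {k : ℕ} (hk : ∀ n ≥ k, f^[n] (φ s) ∉ W) :
    φ t ∉ recurrentPts f := by
  rcases lt_or_gt_of_ne hst with hlt | hgt
  · rw [uIcc_of_le hlt.le] at hsub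
    exact h.notMem_recurrentPts_of_lt hf hA hW hper hs.1 hlt ht.2 hsub hk
  · rw [uIcc_of_ge hgt.le] at hsub
    have := h.flip.notMem_recurrentPts_of_lt hf hA hW hper (s := 1 - s) (t := 1 - t) (k := k)
      (by linarith [hs.2]) (by linarith) (by linarith [ht.1])
      (fun r hr => hsub _ ⟨by linarith [hr.2], by linarith [hr.1]⟩) (by simpa using hk)
    simpa using this

lemma exists_isOpen_disjoint_periodicPts {x : G} (hx : x ∉ closure (periodicPts f)) :
    ∃ W, IsOpen W ∧ x ∈ W ∧ Disjoint W (periodicPts f) :=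
  ⟨_, isClosed_closure.isOpen_compl, hx,
    disjoint_left.2 fun _ hp hq => hp (subset_closure hq)⟩

/-- `cl(R(f)) = R(f) ∪ cl(P(f))` for graph maps. -/
lemma IsTopGraph.mem_closure_periodicPts_of_notMem_recurrentPts (hG : IsTopGraph V)
    (hf : Continuous f) {x : G} (hx : x ∈ closure (recurrentPts f)) (hxr : x ∉ recurrentPts f) :
    x ∈ closure (periodicPts f) := by
  by_contra hxP
  obtain ⟨W₁, hW₁, hxW₁, hper⟩ := exists_isOpen_disjoint_periodicPts hxP
  obtain ⟨N, hN, k, hk⟩ := exists_iterate_notMem_nhds hxr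
  have hxV : x ∈ closure (recurrentPts f \ V) := by
    have hfin : (recurrentPts f ∩ V).Finite := hG.finite_vertexSet.subset inter_subset_right
    rw [← sdiff_union_inter (recurrentPts f) V, closure_union, hfin.isClosed.closure_eq] at hx
    exact hx.resolve_right fun h => hxr h.1
  have hxU : x ∈ closure (⋃ C ∈ connectedComponentIn Vᶜ '' Vᶜ, C ∩ recurrentPts f) := by
    refine closure_mono ?_ hxV
    intro p hp
    exact mem_biUnion (mem_image_of_mem _ hp.2) ⟨mem_connectedComponentIn hp.2, hp.1⟩
  rw [hG.finite_components.closure_biUnion] at hxU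
  obtain ⟨_, ⟨y, hy, rfl⟩, hxC⟩ := mem_iUnion₂.1 hxU
  obtain ⟨φ, hφ⟩ := exists_isEdgeParam hG hy
  obtain ⟨s, hs, rfl⟩ := hφ.closure_subset (closure_mono inter_subset_left hxC)
  have hWs : φ s ∈ W₁ ∩ interior N := ⟨hxW₁, mem_interior_iff_mem_nhds.2 hN⟩
  have hWo : IsOpen (W₁ ∩ interior N) := hW₁.inter isOpen_interior
  obtain ⟨t, ht, htr, hsub⟩ := hφ.exists_uIcc_subset hs hxC (hWo.mem_nhds hWs)
  exact hφ.notMem_recurrentPts hf (hG.isOpen_component y) hWo (hper.mono_left inter_subset_left)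
    hs ht (by rintro rfl; exact hxr htr) hsub
    (fun n hn hmem => hk n hn (interior_subset hmem.2)) htr

lemma IsTopGraph.mem_closure_periodicPts_of_notMem_vertexSet (hG : IsTopGraph V)
    (hf : Continuous f) {x : G} (hxV : x ∉ V) (hxr : x ∈ recurrentPts f)
    (hx : x ∈ closure (evPeriodicPts f)) : x ∈ closure (periodicPts f) := by
  by_contra hxP
  obtain ⟨W, hW, hxW, hper⟩ := exists_isOpen_disjoint_periodicPts hxP
  obtain ⟨φ, hφ⟩ := exists_isEdgeParam hG hxV
  have hA := hG.isOpen_component x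
  have hxA : x ∈ connectedComponentIn Vᶜ x := mem_connectedComponentIn hxV
  obtain ⟨t, ht, hφt⟩ := hφ.image_Ioo.symm ▸ hxA
  have hxc : φ t ∈ closure (connectedComponentIn Vᶜ x ∩ evPeriodicPts f) := by
    rw [hφt]
    exact hA.inter_closure ⟨hxA, hx⟩
  obtain ⟨s, hs, hse, hsub⟩ :=
    hφ.exists_uIcc_subset (Ioo_subset_Icc_self ht) hxc (hφt.symm ▸ hW.mem_nhds hxW)
  obtain ⟨k, hk⟩ := exists_iterate_mem_periodicPts hse
  refine hφ.notMem_recurrentPts hf hA hW hper (Ioo_subset_Icc_self hs) ht ?_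
    (by rwa [uIcc_comm]) (fun n hn => disjoint_right.1 hper (hk n hn)) (hφt.symm ▸ hxr)
  rintro rfl
  exact hxP (subset_closure (mem_periodicPts_of_recurrent_of_evPeriodic hxr (hφt ▸ hse)))

end GraphMap

/-- `cl(R(f)) ∩ cl(EP(f)) = cl(P(f))` for any graph map `f`. -/
theorem closure_recurrent_inter_closure_evPeriodic {G : Type*} [MetricSpace G]
    (V : Set G) (hG : IsTopGraph V) (f : G → G) (hf : Continuous f) :
    closure (recurrentPts f) ∩ closure (evPeriodicPts f) =
      closure (Function.periodicPts f) := by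
  refine Subset.antisymm ?_ (subset_inter (closure_mono periodicPts_subset_recurrentPts)
    (closure_mono periodicPts_subset_evPeriodicPts))
  rintro x ⟨hxR, hxE⟩
  by_cases hxr : x ∈ recurrentPts f
  swap
  · exact hG.mem_closure_periodicPts_of_notMem_recurrentPts hf hxR hxr
  by_cases hxV : ∀ n, f^[n] x ∈ V
  · exact subset_closure (mem_periodicPts_of_recurrent_of_evPeriodic hxr
      (hG.finite_vertexSet.subset (range_subset_iff.2 hxV)))
  obtain ⟨n, hn⟩ := not_forall.1 hxV
  have hnP : f^[n] x ∈ closure (periodicPts f) :=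
    hG.mem_closure_periodicPts_of_notMem_vertexSet hf hn (iterate_mem_recurrentPts hf hxr n)
      (map_mem_closure (hf.iterate n) hxE fun _ hp => iterate_mem_evPeriodicPts hp n)
  by_contra hx
  obtain ⟨m, hnm, hm⟩ := exists_iterate_mem_of_recurrent hxr
    (isClosed_closure.isOpen_compl.mem_nhds hx) n
  apply hm
  rw [← Nat.sub_add_cancel hnm, iterate_add_apply]
  exact iterate_mem_closure_periodicPts hf hnP (m - n)
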